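/- arXiv:1008.1037 — 2 statements merged into one kernel-verified Lean document; each statement's English description precedes it below -/
import Mathlib

section
/- Let ι ∈ W be a perfect involution, r ∈ R(W) and s ∈ S, and suppose ℓ(rιr) = ℓ(sιs) = ℓ(ι) + 2 = ℓ(srιrs) + 2. Then rιr = sιs. (This is property QP2 for the conjugation action of W on its set of perfect involutions with height function ℓ(ι)/2.) -/
open CoxeterSystem

variable {B W : Type*} [Group W] {M : CoxeterMatrix B}

/-- A perfect involution: an involution `ι` such that every reflection `r`
commutes with `ι r ι`. -/
def IsPerfectInvolution (cs : CoxeterSystem M W) (ι : W) : Prop :=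
  ι * ι = 1 ∧ ∀ r : W, cs.IsReflection r → Commute r (ι * r * ι)

namespace Function.End

theorem mul_apply {α : Type*} (f g : Function.End α) (a : α) : (f * g) a = f (g a) := rfl

theorem one_apply {α : Type*} (a : α) : (1 : Function.End α) a = a := rfl

end Function.End

namespace CoxeterSystem

open Classical in
/-- The signed conjugation action of a simple reflection on `W × ZMod 2`. -/
noncomputable def signedConj (cs : CoxeterSystem M W) (i : B) : Function.End (W × ZMod 2) :=
  fun p ↦ (cs.simple i * p.1 * cs.simple i, p.2 + if p.1 = cs.simple i then 1 else 0)

open Classical in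
theorem signedConj_mul_pow_apply (cs : CoxeterSystem M W) (i j : B) (m : ℕ) (p : W × ZMod 2) :
    ((cs.signedConj i * cs.signedConj j) ^ m) p =
      ((cs.simple i * cs.simple j) ^ m * p.1 * ((cs.simple i * cs.simple j) ^ m)⁻¹,
        p.2 + ∑ n ∈ Finset.range (2 * m),
          if p.1 = cs.simple j * (cs.simple i * cs.simple j) ^ n then 1 else 0) := by
  set c := cs.simple i * cs.simple j with hc
  have hconj (k : ℕ) : cs.simple j * c ^ k = (c ^ k)⁻¹ * cs.simple j := by
    have h : SemiconjBy (cs.simple j) c c⁻¹ := by simp [SemiconjBy, hc, mul_assoc]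
    simpa only [inv_pow] using (h.pow_right k).eq
  induction m with
  | zero => simp [Function.End.one_apply]
  | succ m ih =>
    have heven : c ^ m * p.1 * (c ^ m)⁻¹ = cs.simple j ↔ p.1 = cs.simple j * c ^ (2 * m) := by
      rw [two_mul, pow_add, ← mul_assoc, hconj m, mul_assoc (_⁻¹), eq_inv_mul_iff_mul_eq,
        mul_inv_eq_iff_eq_mul]
    have hodd : cs.simple j * (c ^ m * p.1 * (c ^ m)⁻¹) * cs.simple j = cs.simple i ↔
        p.1 = cs.simple j * c ^ (2 * m + 1) := by
      have h : cs.simple j * c ^ (2 * m + 1) = (c ^ m)⁻¹ * (cs.simple j * c) * c ^ m := by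
        rw [show 2 * m + 1 = m + (1 + m) by omega, pow_add, pow_add, pow_one, ← mul_assoc,
          hconj m]
        simp only [mul_assoc]
      rw [h, ← eq_mul_inv_iff_mul_eq, cs.inv_simple, ← hc, ← eq_inv_mul_iff_mul_eq,
        cs.inv_simple, mul_inv_eq_iff_eq_mul, mul_assoc (_⁻¹), eq_inv_mul_iff_mul_eq]
    rw [pow_succ', Function.End.mul_apply, ih, Function.End.mul_apply, signedConj, signedConj,
      show 2 * (m + 1) = 2 * m + 1 + 1 by ring, Finset.sum_range_succ, Finset.sum_range_succ]
    simp only [heven, hodd, add_assoc, Prod.mk.injEq, and_true]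
    rw [pow_succ']
    simp [hc, mul_assoc]

theorem isLiftable_signedConj (cs : CoxeterSystem M W) : M.IsLiftable cs.signedConj := by
  classical
  intro i j
  funext p
  rw [signedConj_mul_pow_apply, two_mul, Finset.sum_range_add]
  simp [Function.End.one_apply, pow_add, CharTwo.add_self_eq_zero]

/-- The number of occurrences modulo 2 of `t` in the left inversion sequence of any word
for `w`. -/
noncomputable def inversionParity (cs : CoxeterSystem M W) (w t : W) : ZMod 2 :=
  (cs.lift ⟨cs.signedConj, cs.isLiftable_signedConj⟩ w⁻¹ (t, 0)).2

section inversionParity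

variable (cs : CoxeterSystem M W)

theorem lift_signedConj_apply (w t : W) (ε : ZMod 2) :
    cs.lift ⟨cs.signedConj, cs.isLiftable_signedConj⟩ w⁻¹ (t, ε) =
      (w⁻¹ * t * w, ε + cs.inversionParity w t) := by
  unfold inversionParity
  induction w using cs.simple_induction_right generalizing t ε with
  | one => simp [Function.End.one_apply]
  | mul_simple_right w i ih =>
    rw [mul_inv_rev, map_mul, cs.inv_simple, cs.lift_apply_simple, Function.End.mul_apply,
      Function.End.mul_apply, ih, ih t 0]
    simp [signedConj, mul_assoc, add_assoc]

theorem inversionParity_mul (x y t : W) :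
    cs.inversionParity (x * y) t =
      cs.inversionParity x t + cs.inversionParity y (x⁻¹ * t * x) := by
  rw [inversionParity, mul_inv_rev, map_mul, Function.End.mul_apply,
    lift_signedConj_apply, lift_signedConj_apply, zero_add]

@[simp]
theorem inversionParity_one (t : W) : cs.inversionParity 1 t = 0 := by
  simpa using cs.inversionParity_mul 1 1 t

open Classical in
theorem inversionParity_simple (i : B) (t : W) :
    cs.inversionParity (cs.simple i) t = if t = cs.simple i then 1 else 0 := by
  rw [inversionParity, cs.inv_simple, cs.lift_apply_simple]
  simp [signedConj]

open Classical in
theorem IsReflection.inversionParity_of_commute {cs : CoxeterSystem M W} {r t : W}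
    (hr : cs.IsReflection r) (hrt : Commute r t) :
    cs.inversionParity r t = if t = r then 1 else 0 := by
  obtain ⟨w, i, rfl⟩ := hr
  have hcancel := cs.inversionParity_mul w w⁻¹ t
  rw [mul_inv_cancel, inversionParity_one] at hcancel
  have hfix : (w * cs.simple i)⁻¹ * t * (w * cs.simple i) = w⁻¹ * t * w := by
    have h : (w * cs.simple i * w⁻¹)⁻¹ * t * (w * cs.simple i * w⁻¹) = t := by
      rw [mul_assoc, ← hrt.eq, inv_mul_cancel_left]
    calc _ = w⁻¹ * ((w * cs.simple i * w⁻¹)⁻¹ * t * (w * cs.simple i * w⁻¹)) * w := by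
            simp [mul_assoc]
      _ = _ := by rw [h]
  have hiff : w⁻¹ * t * w = cs.simple i ↔ t = w * cs.simple i * w⁻¹ := by
    rw [eq_mul_inv_iff_mul_eq, mul_assoc, inv_mul_eq_iff_eq_mul]
  rw [inversionParity_mul, inversionParity_mul, hfix, inversionParity_simple, add_right_comm,
    ← hcancel, zero_add]
  simp only [hiff]

theorem mem_leftInvSeq_of_inversionParity_ne_zero {ω : List B} {t : W}
    (h : cs.inversionParity (cs.wordProd ω) t ≠ 0) : t ∈ cs.leftInvSeq ω := by
  classical
  induction ω generalizing t with
  | nil => simp at h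
  | cons i ω ih =>
    rw [cs.wordProd_cons, inversionParity_mul, inversionParity_simple] at h
    rw [leftInvSeq, List.mem_cons, List.mem_map]
    by_cases ht : t = cs.simple i
    · exact .inl ht
    · rw [if_neg ht, zero_add] at h
      exact .inr ⟨_, ih h, by simp [mul_assoc]⟩

theorem isLeftInversion_of_inversionParity_ne_zero {w t : W}
    (h : cs.inversionParity w t ≠ 0) : cs.IsLeftInversion w t := by
  obtain ⟨ω, hω, rfl⟩ := cs.exists_isReduced w
  exact cs.isLeftInversion_of_mem_leftInvSeq hω
    (cs.mem_leftInvSeq_of_inversionParity_ne_zero h)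

theorem IsReflection.inversionParity_ne_zero_iff {cs : CoxeterSystem M W} {t : W}
    (ht : cs.IsReflection t) (w : W) :
    cs.inversionParity w t ≠ 0 ↔ cs.length (t * w) < cs.length w := by
  refine ⟨fun h ↦ (cs.isLeftInversion_of_inversionParity_ne_zero h).2, fun hlt h ↦ ?_⟩
  have hmul : cs.inversionParity (t * w) t ≠ 0 := by
    rw [inversionParity_mul, ht.inversionParity_of_commute (Commute.refl t)]
    simp [h]
  have := (cs.isLeftInversion_of_inversionParity_ne_zero hmul).2
  rw [← mul_assoc, ht.mul_self, one_mul] at this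
  omega

theorem IsReflection.eq_simple_of_covers {cs : CoxeterSystem M W} {t y : W} {i : B}
    (ht : cs.IsReflection t) (hcov : cs.length (t * y) = cs.length y + 1)
    (hy : ¬cs.IsLeftDescent y i) (hty : cs.IsLeftDescent (t * y) i) : t = cs.simple i := by
  by_contra hne
  have hpar : cs.inversionParity (t * y) t ≠ 0 := by
    rw [ht.inversionParity_ne_zero_iff, ← mul_assoc, ht.mul_self, one_mul]
    omega
  rw [← cs.simple_mul_simple_cancel_left (w := t * y) i, inversionParity_mul,
    inversionParity_simple, if_neg hne, zero_add] at hpar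
  have hlt := (cs.isLeftInversion_of_inversionParity_ne_zero hpar).2
  have heq : (cs.simple i)⁻¹ * t * cs.simple i * (cs.simple i * (t * y)) = cs.simple i * y := by
    rw [← mul_assoc, cs.simple_mul_simple_cancel_right, cs.inv_simple, mul_assoc, ← mul_assoc t,
      ht.mul_self, one_mul]
  rw [heq] at hlt
  rw [cs.isLeftDescent_iff] at hty
  exact hy (by unfold IsLeftDescent; omega)

end inversionParity

end CoxeterSystem

theorem IsPerfectInvolution.length_mul_reflection {cs : CoxeterSystem M W} {ι r : W}
    (hι : IsPerfectInvolution cs ι) (hr : cs.IsReflection r)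
    (h : cs.length (r * ι * r) = cs.length ι + 2) :
    cs.length (ι * r) = cs.length ι + 1 := by
  classical
  obtain ⟨hsq, hcomm⟩ := hι
  have hinv : ι⁻¹ = ι := inv_eq_of_mul_eq_one_left hsq
  have hne : ι * r * ι ≠ r := by
    intro heq
    have hrι : r * ι * r = ι := by
      rw [mul_assoc, ← one_mul (r * _), ← hsq]
      simpa [mul_assoc, hr.mul_self] using congrArg (ι * · * r) heq
    rw [hrι] at h
    omega
  have hpar : cs.inversionParity (r * ι * r) r = 1 + cs.inversionParity ι r := by
    rw [mul_assoc, cs.inversionParity_mul, cs.inversionParity_mul,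
      hr.inversionParity_of_commute (Commute.refl r), inv_mul_cancel, one_mul, hinv,
      hr.inversionParity_of_commute (hcomm r hr), if_neg hne, if_pos rfl, add_zero]
  have hflip : cs.length (r * ι) = cs.length (ι * r) := by
    rw [← cs.length_inv, mul_inv_rev, hinv, hr.inv]
  have hu := hr.inversionParity_ne_zero_iff (r * ι * r)
  have hι' := hr.inversionParity_ne_zero_iff ι
  rw [hpar, mul_assoc, ← mul_assoc r, hr.mul_self, one_mul, ← mul_assoc, h] at hu
  rw [hflip] at hι'
  have hlne := hr.length_mul_left_ne ι
  by_cases h0 : cs.inversionParity ι r = 0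
  · have := hu.1 (by simp [h0])
    have : ¬ cs.length (ι * r) < cs.length ι := fun hlt ↦ hι'.2 hlt h0
    omega
  · have h1 : 1 + cs.inversionParity ι r = 0 := by
      revert h0
      generalize cs.inversionParity ι r = a
      decide +revert
    have := hι'.1 h0
    have : ¬ cs.length (ι * r) < cs.length ι + 2 := fun hlt ↦ hu.2 hlt h1
    omega

/-- QP2 for perfect involutions: if `ι` is a perfect involution,
`r` a reflection and `s` a simple reflection with
`ℓ(rιr) = ℓ(sιs) = ℓ(ι) + 2 = ℓ(srιrs) + 2`, then `rιr = sιs`. -/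
theorem perfect_involution_qp2 (cs : CoxeterSystem M W) (ι : W)
    (hι : IsPerfectInvolution cs ι) (r : W) (hr : cs.IsReflection r) (b : B)
    (h1 : cs.length (r * ι * r) = cs.length (cs.simple b * ι * cs.simple b))
    (h2 : cs.length (cs.simple b * ι * cs.simple b) = cs.length ι + 2)
    (h3 : cs.length ι + 2 =
      cs.length (cs.simple b * r * ι * r * cs.simple b) + 2) :
    r * ι * r = cs.simple b * ι * cs.simple b := by
  have hcov := hι.length_mul_reflection hr (h1.trans h2)
  obtain ⟨hsq, hcomm⟩ := hι
  have hinv : ι⁻¹ = ι := inv_eq_of_mul_eq_one_left hsq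
  have hι_desc : ¬cs.IsLeftDescent ι b := by
    have := cs.length_mul_simple (cs.simple b * ι) b
    unfold IsLeftDescent
    omega
  have hu_desc : cs.IsLeftDescent (r * (ι * r)) b := by
    have h := cs.length_mul_simple (cs.simple b * (r * (ι * r))) b
    unfold IsLeftDescent
    simp only [mul_assoc] at h h1 h2 h3 ⊢
    omega
  by_cases hx : cs.IsLeftDescent (ι * r) b
  · have ht : cs.IsReflection (ι * r * ι) := by simpa [hinv] using hr.conj ι
    have hmul : ι * r * ι * ι = ι * r := by rw [mul_assoc, hsq, mul_one]
    have hs : ι * r * ι = cs.simple b :=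
      ht.eq_simple_of_covers (by rw [hmul, hcov]) hι_desc (by rwa [hmul])
    have hrt := (hcomm r hr).eq
    rw [← hs]
    calc r * ι * r = r * (ι * r * ι) * ι := by rw [mul_assoc r (ι * r * ι), hmul, mul_assoc]
      _ = ι * r * ι * ι * (ι * r * ι) := by
        rw [hrt, hmul]
        simp only [mul_assoc]
  · have hs : r = cs.simple b := by
      refine hr.eq_simple_of_covers ?_ hx hu_desc
      rw [← mul_assoc]
      omega
    rw [hs]
end

section
/- Let (X, hgt) be a transitive quasiparabolic W-set with a W-minimal element x₀ of height 0, and let y = s₁s₂⋯s_k·x₀ be a reduced expression (s_i ∈ S, k = hgt(y)). Then for x ∈ X, x ≤ y in the Bruhat order if and only if x = s_{i₁}s_{i₂}⋯s_{i_j}·x₀ for some indices 1 ≤ i₁ < i₂ < ⋯ < i_j ≤ k. -/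
open CoxeterSystem

variable {B W : Type*} [Group W] {M : CoxeterMatrix B}

/-- A scaled `W`-set: heights change by at most 1 under simple reflections. -/
def IsScaled (cs : CoxeterSystem M W) {X : Type*} [MulAction W X] (hgt : X → ℤ) : Prop :=
  ∀ (b : B) (x : X), |hgt (cs.simple b • x) - hgt x| ≤ 1

/-- A quasiparabolic `W`-set: scaled, plus (QP1) and (QP2). -/
def IsQuasiparabolic (cs : CoxeterSystem M W) {X : Type*} [MulAction W X] (hgt : X → ℤ) : Prop :=
  IsScaled cs hgt ∧
  (∀ (r : W) (x : X), cs.IsReflection r → hgt (r • x) = hgt x → r • x = x) ∧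
  (∀ (r : W) (b : B) (x : X), cs.IsReflection r → hgt x < hgt (r • x) →
    hgt (cs.simple b • r • x) < hgt (cs.simple b • x) → r • x = cs.simple b • x)
/-- The Bruhat order on a quasiparabolic `W`-set: the reflexive–transitive closure
of the relation `x ≺ r • x` for reflections `r` with `hgt x < hgt (r • x)`. -/
def BruhatLE (cs : CoxeterSystem M W) {X : Type*} [MulAction W X] (hgt : X → ℤ) :
    X → X → Prop :=
  Relation.ReflTransGen (fun x y => ∃ r : W, cs.IsReflection r ∧ y = r • x ∧ hgt x < hgt y)

/-- The strict Bruhat order. -/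
def BruhatLT (cs : CoxeterSystem M W) {X : Type*} [MulAction W X] (hgt : X → ℤ)
    (x y : X) : Prop :=
  BruhatLE cs hgt x y ∧ x ≠ y

namespace IsQuasiparabolic

variable {X : Type*} [MulAction W X] {cs : CoxeterSystem M W} {hgt : X → ℤ}

theorem smul_eq_or_bruhatLE_smul (hqp : IsQuasiparabolic cs hgt) {x z : X} {r : W}
    (hr : cs.IsReflection r) (hz : z = r • x) (hlt : hgt x < hgt z) (b : B) :
    z = cs.simple b • x ∨ BruhatLE cs hgt (cs.simple b • x) (cs.simple b • z) := by
  subst hz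
  have hconj := hr.conj (cs.simple b)
  have hact : (cs.simple b * r * (cs.simple b)⁻¹) • cs.simple b • x =
      cs.simple b • r • x := by
    simp [smul_smul, mul_assoc]
  rcases lt_trichotomy (hgt (cs.simple b • r • x)) (hgt (cs.simple b • x)) with h | h | h
  · exact Or.inl (hqp.2.2 r b x hr hlt h)
  · have hfix := hqp.2.1 _ (cs.simple b • x) hconj (by rw [hact, h])
    rw [hact] at hfix
    rw [MulAction.injective (cs.simple b) hfix] at hlt
    exact absurd hlt (lt_irrefl _)
  · exact Or.inr (Relation.ReflTransGen.single ⟨_, hconj, hact.symm, h⟩)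

theorem bruhatLE_simple_smul (hqp : IsQuasiparabolic cs hgt) {b : B} {x : X}
    (h : hgt x ≤ hgt (cs.simple b • x)) : BruhatLE cs hgt x (cs.simple b • x) := by
  rcases h.lt_or_eq with h | h
  · exact Relation.ReflTransGen.single ⟨_, cs.isReflection_simple b, rfl, h⟩
  · rw [hqp.2.1 _ x (cs.isReflection_simple b) h.symm]
    exact Relation.ReflTransGen.refl

theorem smul_bruhatLE_or_bruhatLE (hqp : IsQuasiparabolic cs hgt) (b : B) {x y : X}
    (h : BruhatLE cs hgt x (cs.simple b • y)) :
    BruhatLE cs hgt (cs.simple b • x) y ∨ BruhatLE cs hgt x y := by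
  induction h using Relation.ReflTransGen.head_induction_on with
  | refl =>
    left
    rw [smul_smul, cs.simple_mul_simple_self, one_smul]
    exact Relation.ReflTransGen.refl
  | head hxz _ ih =>
    obtain ⟨r, hr, hz, hlt⟩ := id hxz
    rcases ih with ih | ih
    · rcases hqp.smul_eq_or_bruhatLE_smul hr hz hlt b with h | h
      · right
        rwa [h, smul_smul, cs.simple_mul_simple_self, one_smul] at ih
      · exact Or.inl (Relation.ReflTransGen.trans h ih)
    · exact Or.inr (Relation.ReflTransGen.head hxz ih)

theorem smul_bruhatLE_smul (hqp : IsQuasiparabolic cs hgt) {b : B} {x y : X}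
    (hy : hgt y ≤ hgt (cs.simple b • y)) (h : BruhatLE cs hgt x y) :
    BruhatLE cs hgt (cs.simple b • x) (cs.simple b • y) := by
  induction h using Relation.ReflTransGen.head_induction_on with
  | refl => exact Relation.ReflTransGen.refl
  | head hxz hzy ih =>
    obtain ⟨r, hr, hz, hlt⟩ := hxz
    rcases hqp.smul_eq_or_bruhatLE_smul hr hz hlt b with h | h
    · rw [← h]
      exact Relation.ReflTransGen.trans hzy (hqp.bruhatLE_simple_smul hy)
    · exact Relation.ReflTransGen.trans h ih

/-- A minimal element lies below its whole orbit: its upper set in the Bruhat order is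
stable under simple reflections. -/
theorem bruhatLE_smul_of_minimal (hqp : IsQuasiparabolic cs hgt) {x₀ : X}
    (hmin : ∀ b : B, hgt x₀ ≤ hgt (cs.simple b • x₀)) (w : W) :
    BruhatLE cs hgt x₀ (w • x₀) := by
  induction w using cs.simple_induction_left with
  | one =>
    rw [one_smul]
    exact Relation.ReflTransGen.refl
  | mul_simple_left w b ih =>
    rw [mul_smul]
    have h : BruhatLE cs hgt x₀ (cs.simple b • cs.simple b • w • x₀) := by
      rwa [smul_smul (cs.simple b), cs.simple_mul_simple_self, one_smul]
    rcases hqp.smul_bruhatLE_or_bruhatLE b h with h | h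
    · exact Relation.ReflTransGen.trans (hqp.bruhatLE_simple_smul (hmin b)) h
    · exact h

end IsQuasiparabolic

theorem BruhatLE.eq_or_hgt_lt {X : Type*} [MulAction W X] {cs : CoxeterSystem M W}
    {hgt : X → ℤ} {x y : X} (h : BruhatLE cs hgt x y) : x = y ∨ hgt x < hgt y := by
  induction h with
  | refl => exact Or.inl rfl
  | tail _ hstep ih =>
    obtain ⟨_, _, _, hlt⟩ := hstep
    rcases ih with rfl | ih
    · exact Or.inr hlt
    · exact Or.inr (ih.trans hlt)

theorem IsScaled.hgt_wordProd_smul_le {X : Type*} [MulAction W X] {cs : CoxeterSystem M W}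
    {hgt : X → ℤ} (hs : IsScaled cs hgt) (l : List B) (x : X) :
    hgt (cs.wordProd l • x) ≤ hgt x + l.length := by
  induction l with
  | nil => simp
  | cons b m ih =>
    have h := (abs_le.mp (hs b (cs.wordProd m • x))).2
    rw [cs.wordProd_cons, mul_smul, List.length_cons]
    push_cast
    linarith

/-- subword property: in a transitive quasiparabolic `W`-set with
minimal element `x₀` of height `0`, given a reduced expression `y = s₁ ⋯ s_k • x₀`,
one has `x ≤ y` in Bruhat order iff `x` is obtained from a subword. -/
theorem bruhat_subword (cs : CoxeterSystem M W) {X : Type*} [MulAction W X]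
    [MulAction.IsPretransitive W X]
    (hgt : X → ℤ) (hqp : IsQuasiparabolic cs hgt) (x₀ : X)
    (hmin : ∀ b : B, hgt x₀ ≤ hgt (cs.simple b • x₀)) (h0 : hgt x₀ = 0)
    (l : List B) (y : X) (hy : y = cs.wordProd l • x₀)
    (hred : (l.length : ℤ) = hgt y) (x : X) :
    BruhatLE cs hgt x y ↔
      ∃ l' : List B, l'.Sublist l ∧ x = cs.wordProd l' • x₀ := by
  induction l generalizing x y with
  | nil =>
    rw [cs.wordProd_nil, one_smul] at hy
    subst hy
    constructor
    · intro h
      refine ⟨[], List.Sublist.refl _, ?_⟩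
      rw [cs.wordProd_nil, one_smul]
      obtain ⟨w, rfl⟩ := MulAction.exists_smul_eq W y x
      rcases h.eq_or_hgt_lt with h | h
      · exact h
      · rcases (hqp.bruhatLE_smul_of_minimal hmin w).eq_or_hgt_lt with h' | h'
        · exact h'.symm
        · exact absurd h h'.not_gt
    · rintro ⟨l', hl', rfl⟩
      rw [List.sublist_nil.mp hl', cs.wordProd_nil, one_smul]
      exact Relation.ReflTransGen.refl
  | cons b m ih =>
    rw [cs.wordProd_cons, mul_smul] at hy
    subst hy
    have hstep := (abs_le.mp (hqp.1 b (cs.wordProd m • x₀))).2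
    have hle := hqp.1.hgt_wordProd_smul_le m x₀
    rw [List.length_cons] at hred
    push_cast at hred
    have hm : (m.length : ℤ) = hgt (cs.wordProd m • x₀) := by linarith
    have hup : hgt (cs.wordProd m • x₀) ≤ hgt (cs.simple b • cs.wordProd m • x₀) := by linarith
    constructor
    · intro h
      rcases hqp.smul_bruhatLE_or_bruhatLE b h with h | h
      · obtain ⟨l', hl', hx⟩ := (ih _ rfl hm _).mp h
        refine ⟨b :: l', hl'.cons_cons b, ?_⟩
        rw [cs.wordProd_cons, mul_smul, ← hx, smul_smul, cs.simple_mul_simple_self, one_smul]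
      · obtain ⟨l', hl', hx⟩ := (ih _ rfl hm _).mp h
        exact ⟨l', hl'.cons b, hx⟩
    · rintro ⟨l', hl', rfl⟩
      rcases List.sublist_cons_iff.mp hl' with h | ⟨m', rfl, h⟩
      · exact Relation.ReflTransGen.trans ((ih _ rfl hm _).mpr ⟨l', h, rfl⟩)
          (hqp.bruhatLE_simple_smul hup)
      · rw [cs.wordProd_cons, mul_smul]
        exact hqp.smul_bruhatLE_smul hup ((ih _ rfl hm _).mpr ⟨m', h, rfl⟩)
end
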